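/- Let K be an algebraically closed field of characteristic 0 and let d ≥ 4. A nonsingular homogeneous polynomial F ∈ K[X,Y,Z] of degree d has an automorphism of order d(d−1) (i.e. Aut(F) contains an element of order d(d−1)) if and only if F is projectively equivalent to X^d + Y^d + α·X·Z^{d−1} for some α ∈ K^×. Moreover, if d ≥ 5 and F = X^d + Y^d + α·X·Z^{d−1} with α ∈ K^×, then Aut(F) is cyclic of order d(d−1). -/

import Mathlib

open MvPolynomial Matrix

noncomputable section

variable {K : Type*} [Field K]

/-- The substitution `F ∘ A`, i.e. `X i ↦ ∑ j, A i j • X j`. -/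
def substPoly (A : Matrix (Fin 3) (Fin 3) K) (F : MvPolynomial (Fin 3) K) :
    MvPolynomial (Fin 3) K :=
  aeval (fun i => ∑ j, A i j • X j) F

lemma substPoly_one (F : MvPolynomial (Fin 3) K) : substPoly 1 F = F := by
  have h : (fun i => ∑ j, (1 : Matrix (Fin 3) (Fin 3) K) i j • X j)
      = (X : Fin 3 → MvPolynomial (Fin 3) K) := by
    funext i
    simp [Matrix.one_apply, ite_smul]
  rw [substPoly, h]
  exact aeval_X_left_apply F

lemma substPoly_smul (A : Matrix (Fin 3) (Fin 3) K) (c : K) (F : MvPolynomial (Fin 3) K) :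
    substPoly A (c • F) = c • substPoly A F := by
  unfold substPoly
  exact _root_.map_smul (aeval fun i => ∑ j, A i j • X j) c F

lemma substPoly_mul (A B : Matrix (Fin 3) (Fin 3) K) (F : MvPolynomial (Fin 3) K) :
    substPoly (A * B) F = substPoly B (substPoly A F) := by
  have hfun : (fun i => ∑ j, (A * B) i j • (X j : MvPolynomial (Fin 3) K))
      = fun i => (aeval fun i => (∑ j, B i j • X j : MvPolynomial (Fin 3) K))
          (∑ j, A i j • X j : MvPolynomial (Fin 3) K) := by
    funext i
    rw [map_sum]
    simp only [_root_.map_smul, aeval_X, Matrix.mul_apply, Finset.sum_smul, Finset.smul_sum, smul_smul]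
    exact Finset.sum_comm
  have h1 : substPoly (A * B) F
      = aeval (fun i => (aeval fun i => (∑ j, B i j • X j : MvPolynomial (Fin 3) K))
          (∑ j, A i j • X j : MvPolynomial (Fin 3) K)) F := by
    unfold substPoly
    exact congrArg
      (fun f => (aeval f : MvPolynomial (Fin 3) K →ₐ[K] MvPolynomial (Fin 3) K) F) hfun
  rw [h1, ← MvPolynomial.comp_aeval]
  rfl

/-- The subgroup of `GL₃(K)` preserving the polynomial `F` up to scalar. -/
def autGL (F : MvPolynomial (Fin 3) K) : Subgroup (GL (Fin 3) K) where
  carrier := {A | ∃ c : Kˣ, substPoly (A : Matrix (Fin 3) (Fin 3) K) F = (c : K) • F}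
  one_mem' := ⟨1, by simp [substPoly_one]⟩
  mul_mem' := by
    rintro A B ⟨c, hc⟩ ⟨e, he⟩
    refine ⟨c * e, ?_⟩
    have hAB : ((A * B : GL (Fin 3) K) : Matrix (Fin 3) (Fin 3) K)
        = (A : Matrix (Fin 3) (Fin 3) K) * (B : Matrix (Fin 3) (Fin 3) K) := rfl
    rw [hAB, substPoly_mul, hc, substPoly_smul, he, smul_smul, ← Units.val_mul]
  inv_mem' := by
    rintro A ⟨c, hc⟩
    refine ⟨c⁻¹, ?_⟩
    have key : (c : K) • substPoly ((A⁻¹ : GL (Fin 3) K) : Matrix (Fin 3) (Fin 3) K) F = F := by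
      rw [← substPoly_smul, ← hc, ← substPoly_mul]
      have h1 : (A : Matrix (Fin 3) (Fin 3) K) *
          ((A⁻¹ : GL (Fin 3) K) : Matrix (Fin 3) (Fin 3) K) = 1 := by
        exact_mod_cast Units.mul_inv A
      rw [h1, substPoly_one]
    calc substPoly ((A⁻¹ : GL (Fin 3) K) : Matrix (Fin 3) (Fin 3) K) F
        = ((c : K)⁻¹ * (c : K)) •
            substPoly ((A⁻¹ : GL (Fin 3) K) : Matrix (Fin 3) (Fin 3) K) F := by
          rw [inv_mul_cancel₀ (Units.ne_zero c), one_smul]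
      _ = (c : K)⁻¹ • ((c : K) •
            substPoly ((A⁻¹ : GL (Fin 3) K) : Matrix (Fin 3) (Fin 3) K) F) := by
          rw [smul_smul]
      _ = (c : K)⁻¹ • F := by rw [key]
      _ = ((c⁻¹ : Kˣ) : K) • F := by rw [Units.val_inv_eq_inv_val]

/-- `PGL₃(K)`: the quotient of `GL₃(K)` by its center (the scalar matrices). -/
abbrev PGL3 (K : Type*) [Field K] := GL (Fin 3) K ⧸ Subgroup.center (GL (Fin 3) K)

/-- The automorphism group of the plane curve `F = 0`, as a subgroup of `PGL₃(K)`: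
the classes of matrices `A` with `F ∘ A = λ • F` for some `λ ∈ Kˣ`. -/
def projAut (F : MvPolynomial (Fin 3) K) : Subgroup (PGL3 K) :=
  (autGL F).map (QuotientGroup.mk' (Subgroup.center (GL (Fin 3) K)))

/-- `F` is nonsingular: the only common zero of its partial derivatives is the origin. -/
def IsNonsingular (F : MvPolynomial (Fin 3) K) : Prop :=
  ∀ x : Fin 3 → K, (∀ i, eval x (pderiv i F) = 0) → x = 0

/-- `F` and `G` are projectively equivalent: `F ∘ A = λ • G` for some `A ∈ GL₃(K)`, `λ ∈ Kˣ`. -/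
def ProjEquiv (F G : MvPolynomial (Fin 3) K) : Prop :=
  ∃ A : GL (Fin 3) K, ∃ c : Kˣ,
    substPoly (A : Matrix (Fin 3) (Fin 3) K) F = (c : K) • G



section basics

lemma substPoly_add (A : Matrix (Fin 3) (Fin 3) K) (F G : MvPolynomial (Fin 3) K) :
    substPoly A (F + G) = substPoly A F + substPoly A G := map_add _ _ _

lemma substPoly_pmul (A : Matrix (Fin 3) (Fin 3) K) (F G : MvPolynomial (Fin 3) K) :
    substPoly A (F * G) = substPoly A F * substPoly A G := map_mul _ _ _

lemma substPoly_pow (A : Matrix (Fin 3) (Fin 3) K) (F : MvPolynomial (Fin 3) K) (n : ℕ) :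
    substPoly A (F ^ n) = substPoly A F ^ n := map_pow _ _ _

lemma substPoly_C (A : Matrix (Fin 3) (Fin 3) K) (c : K) :
    substPoly A (C c) = C c := by
  unfold substPoly; rw [aeval_C]; rfl

lemma substPoly_X (A : Matrix (Fin 3) (Fin 3) K) (i : Fin 3) :
    substPoly A (X i) = ∑ j, A i j • X j := by
  unfold substPoly; rw [aeval_X]

lemma eval_substPoly (A : Matrix (Fin 3) (Fin 3) K) (F : MvPolynomial (Fin 3) K) (x : Fin 3 → K) :
    eval x (substPoly A F) = eval (A *ᵥ x) F := by
  induction F using MvPolynomial.induction_on with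
  | C a => rw [substPoly_C]; simp
  | add p q hp hq => rw [substPoly_add]; simp [hp, hq]
  | mul_X p i hp =>
    rw [substPoly_pmul, substPoly_X, map_mul, map_mul, hp]
    congr 1
    simp [Matrix.mulVec, dotProduct, smul_eval]

lemma pderiv_substPoly (A : Matrix (Fin 3) (Fin 3) K) (F : MvPolynomial (Fin 3) K) (j : Fin 3) :
    pderiv j (substPoly A F) = ∑ i, A i j • substPoly A (pderiv i F) := by
  induction F using MvPolynomial.induction_on with
  | C a => simp [substPoly_C]; simp [substPoly]
  | add p q hp hq => 
    simp only [substPoly_add, map_add, hp, hq, smul_add, Finset.sum_add_distrib]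
  | mul_X p i hp =>
    rw [substPoly_pmul, pderiv_mul, hp]
    have h1 : pderiv j (substPoly A (X i)) = C (A i j) := by
      rw [substPoly_X, map_sum]
      simp only [Derivation.map_smul, pderiv_X, Pi.single_apply, smul_ite, smul_zero]
      simp [MvPolynomial.smul_eq_C_mul]
    rw [h1]
    have h2 : ∀ k, substPoly A (pderiv k (p * X i)) =
        substPoly A (pderiv k p) * substPoly A (X i) + 
          (if k = i then substPoly A p else 0) := by
      intro k
      rw [pderiv_mul, substPoly_add, substPoly_pmul, substPoly_pmul, pderiv_X]
      congr 1
      by_cases h : k = i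
      · subst h; simp [substPoly]
      · simp [h, Ne.symm h, substPoly]
    simp only [h2, smul_add, Finset.sum_add_distrib, Finset.sum_mul, smul_ite, smul_zero]
    simp [MvPolynomial.smul_eq_C_mul, mul_comm, mul_left_comm]

/-- linear substitution by an invertible matrix, as a ring equivalence -/
def substEquiv (A : GL (Fin 3) K) : MvPolynomial (Fin 3) K ≃+* MvPolynomial (Fin 3) K where
  toFun := substPoly (A : Matrix (Fin 3) (Fin 3) K)
  invFun := substPoly ((A⁻¹ : GL (Fin 3) K) : Matrix (Fin 3) (Fin 3) K)
  left_inv F := by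
    rw [← substPoly_mul, ← Units.val_mul, mul_inv_cancel, Units.val_one, substPoly_one]
  right_inv F := by
    rw [← substPoly_mul, ← Units.val_mul, inv_mul_cancel, Units.val_one, substPoly_one]
  map_mul' F G := substPoly_pmul _ F G
  map_add' F G := substPoly_add _ F G

lemma substEquiv_apply (A : GL (Fin 3) K) (F : MvPolynomial (Fin 3) K) :
    substEquiv A F = substPoly (A : Matrix (Fin 3) (Fin 3) K) F := rfl

lemma nonsing_subst (A : GL (Fin 3) K) (F : MvPolynomial (Fin 3) K) (h : IsNonsingular F) :
    IsNonsingular (substPoly (A : Matrix (Fin 3) (Fin 3) K) F) := by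
  intro x hx
  have h1 : (A : Matrix (Fin 3) (Fin 3) K)ᵀ *ᵥ
      (fun i => eval ((A : Matrix (Fin 3) (Fin 3) K) *ᵥ x) (pderiv i F)) = 0 := by
    funext j
    have := hx j
    rw [pderiv_substPoly, map_sum] at this
    simp only [smul_eval, eval_substPoly] at this
    simpa [Matrix.mulVec, dotProduct] using this
  have hdet : IsUnit (A : Matrix (Fin 3) (Fin 3) K) := A.isUnit
  have hT : IsUnit ((A : Matrix (Fin 3) (Fin 3) K)ᵀ) := by
    rwa [Matrix.isUnit_transpose]
  have h2 := Matrix.mulVec_injective_of_isUnit hT (h1.trans (Matrix.mulVec_zero _).symm)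
  have h3 := h _ (fun i => congrFun h2 i)
  exact Matrix.mulVec_injective_of_isUnit hdet (h3.trans (Matrix.mulVec_zero _).symm)

lemma homog_subst (A : Matrix (Fin 3) (Fin 3) K) (F : MvPolynomial (Fin 3) K) (d : ℕ)
    (h : F.IsHomogeneous d) : (substPoly A F).IsHomogeneous d := by
  have := h.aeval (φ := F) (n := 1) (fun i => ∑ j, A i j • (X j : MvPolynomial (Fin 3) K)) (fun i => by
    refine IsHomogeneous.sum _ _ _ (fun j _ => ?_)
    rw [MvPolynomial.smul_eq_C_mul]
    simpa using (isHomogeneous_C (Fin 3) (A i j)).mul (isHomogeneous_X K j))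
  rw [one_mul] at this
  exact this

/-- the autGL condition from any scalar -/
lemma autGL_conj {F G : MvPolynomial (Fin 3) K} (B : GL (Fin 3) K) (c : Kˣ)
    (hB : substPoly (B : Matrix (Fin 3) (Fin 3) K) F = (c : K) • G) (A : GL (Fin 3) K) :
    B * A * B⁻¹ ∈ autGL F ↔ A ∈ autGL G := by
  have hG : substPoly ((B⁻¹ : GL (Fin 3) K) : Matrix (Fin 3) (Fin 3) K) ((c:K) • G) = F := by
    rw [← hB, ← substPoly_mul, ← Units.val_mul, mul_inv_cancel, Units.val_one, substPoly_one]
  constructor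
  · rintro ⟨l, hl⟩
    refine ⟨l, ?_⟩
    have : substPoly ((B * A * B⁻¹ * B : GL (Fin 3) K) : Matrix (Fin 3) (Fin 3) K) F
       = (l : K) • (c : K) • G := by
      rw [Units.val_mul, substPoly_mul, hl, substPoly_smul, hB]
    rw [inv_mul_cancel_right, Units.val_mul, substPoly_mul, hB, substPoly_smul, smul_comm] at this
    exact (smul_right_injective _ c.ne_zero) this
  · rintro ⟨l, hl⟩
    refine ⟨l, ?_⟩
    rw [Units.val_mul, Units.val_mul, substPoly_mul, substPoly_mul, hB, substPoly_smul, hl,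
      smul_comm, substPoly_smul, hG]

lemma mem_center_iff' (A : GL (Fin 3) K) : A ∈ Subgroup.center (GL (Fin 3) K) ↔
    ∃ c : K, (A : Matrix (Fin 3) (Fin 3) K) = Matrix.diagonal (fun _ => c) := by
  rw [Matrix.GeneralLinearGroup.mem_center_iff_val_mem_range_scalar]
  simp [Set.mem_range, Matrix.scalar_apply, eq_comm]

end basics

section diagonalization

/-- diagonal matrices in `GL₃` -/
def dg : (Fin 3 → Kˣ) →* GL (Fin 3) K :=
  (Units.map (Matrix.diagonalRingHom (Fin 3) K).toMonoidHom).comp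
    MulEquiv.piUnits.symm.toMonoidHom

lemma dg_val (t : Fin 3 → Kˣ) :
    (dg t : Matrix (Fin 3) (Fin 3) K) = Matrix.diagonal (fun i => (t i : K)) := rfl

lemma dg_mem_center (t : Fin 3 → Kˣ) :
    dg t ∈ Subgroup.center (GL (Fin 3) K) ↔ t 1 = t 0 ∧ t 2 = t 0 := by
  rw [mem_center_iff', dg_val]
  constructor
  · rintro ⟨c, hc⟩
    have h := fun i => congrFun (congrFun hc i) i
    simp only [Matrix.diagonal_apply_eq] at h
    exact ⟨Units.ext ((h 1).trans (h 0).symm), Units.ext ((h 2).trans (h 0).symm)⟩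
  · rintro ⟨h1, h2⟩
    refine ⟨t 0, ?_⟩
    congr 1
    funext i
    fin_cases i
    · rfl
    · exact congrArg _ h1
    · exact congrArg _ h2

lemma exists_eigenbasis [IsAlgClosed K] [CharZero K] (A : GL (Fin 3) K) (n : ℕ) (hn : 0 < n)
    (hA : A ^ n ∈ Subgroup.center (GL (Fin 3) K)) :
    ∃ b : Module.Basis (Fin 3) K (Fin 3 → K), ∃ u : Fin 3 → K,
      ∀ i, (A : Matrix (Fin 3) (Fin 3) K) *ᵥ b i = u i • b i := by
  classical
  obtain ⟨c, hc⟩ := (mem_center_iff' _).1 hA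
  have hc0 : c ≠ 0 := by
    rintro rfl
    have h := (A ^ n).isUnit
    rw [hc, Matrix.isUnit_iff_isUnit_det] at h
    simp at h
  set f : Module.End K (Fin 3 → K) := Matrix.toLin' (A : Matrix (Fin 3) (Fin 3) K) with hf
  have hfn : f ^ n = algebraMap K _ c := by
    rw [hf, ← Matrix.toLin'_pow, ← Units.val_pow_eq_pow_val, hc]
    ext i j
    simp [Matrix.mulVec_diagonal, Module.algebraMap_end_apply]
  have hss : f.IsSemisimple := by
    apply Module.End.isSemisimple_of_squarefree_aeval_eq_zero (p := Polynomial.X ^ n - Polynomial.C c)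
    · apply Polynomial.Separable.squarefree
      exact Polynomial.separable_X_pow_sub_C c (by exact_mod_cast hn.ne') hc0
    · simp [hfn]
  have hInt := DirectSum.isInternal_submodule_of_iSupIndep_of_iSup_eq_top
    f.eigenspaces_iSupIndep hss.iSup_eigenspace_eq_top
  let v := fun μ : K => Module.finBasis K (f.eigenspace μ)
  let b0 := hInt.collectedBasis v
  have hfin : Finite (Σ μ : K, Fin (Module.finrank K (f.eigenspace μ))) :=
    Module.Finite.finite_basis b0
  have hcard : Nat.card (Σ μ : K, Fin (Module.finrank K (f.eigenspace μ))) = Nat.card (Fin 3) := by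
    rw [← Module.finrank_eq_nat_card_basis b0]; simp
  let e := Finite.equivFinOfCardEq (n := 3) (hcard.trans (by simp))
  let b := b0.reindex e
  have hb : ∀ i, f (b i) = (e.symm i).1 • b i := by
    intro i
    have := hInt.collectedBasis_mem v (e.symm i)
    rw [Module.End.mem_eigenspace_iff] at this
    simpa [b, b0] using this
  exact ⟨b, fun i => (e.symm i).1, hb⟩

lemma exists_diag [IsAlgClosed K] [CharZero K] (A : GL (Fin 3) K) (n : ℕ) (hn : 0 < n)
    (hA : A ^ n ∈ Subgroup.center (GL (Fin 3) K)) :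
    ∃ B : GL (Fin 3) K, ∃ t : Fin 3 → Kˣ, A = B * dg t * B⁻¹ := by
  obtain ⟨b, u, hb⟩ := exists_eigenbasis A n hn hA
  let Bm : Matrix (Fin 3) (Fin 3) K := (Pi.basisFun K (Fin 3)).toMatrix b
  have hBm : ∀ i j, Bm i j = b j i := fun i j => by simp [Bm, Module.Basis.toMatrix_apply]
  let B : GL (Fin 3) K := ⟨Bm, b.toMatrix (Pi.basisFun K (Fin 3)),
    Module.Basis.toMatrix_mul_toMatrix_flip _ _, Module.Basis.toMatrix_mul_toMatrix_flip _ _⟩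
  have hAB : (A : Matrix (Fin 3) (Fin 3) K) * Bm = Bm * Matrix.diagonal u := by
    ext i j
    rw [Matrix.mul_diagonal, hBm, Matrix.mul_apply]
    have := congrFun (hb j) i
    simp only [Matrix.mulVec, dotProduct, Pi.smul_apply, smul_eq_mul] at this
    simp only [hBm, this, mul_comm]
  have hu : ∀ i, u i ≠ 0 := by
    have h1 : IsUnit (Bm * Matrix.diagonal u) := by
      rw [← hAB]; exact (A * B).isUnit
    have h2 : IsUnit (Matrix.diagonal u) := by
      have := (B⁻¹).isUnit.mul h1
      rwa [← mul_assoc, show (((B⁻¹ : GL (Fin 3) K) : Matrix (Fin 3) (Fin 3) K) * Bm) = 1 from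
        Units.inv_mul B, one_mul] at this
    rw [Matrix.isUnit_iff_isUnit_det, Matrix.det_diagonal, isUnit_iff_ne_zero,
      Finset.prod_ne_zero_iff] at h2
    exact fun i => h2 i (Finset.mem_univ i)
  refine ⟨B, fun i => Units.mk0 (u i) (hu i), ?_⟩
  rw [eq_mul_inv_iff_mul_eq]
  apply Units.ext
  rw [Units.val_mul, Units.val_mul, dg_val]
  exact hAB

end diagonalization

section cases

lemma eval_single_of_homog {G : MvPolynomial (Fin 3) K} {e : ℕ} (hG : G.IsHomogeneous e)
    (i : Fin 3) : eval (Pi.single i 1) G = coeff (Finsupp.single i e) G := by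
  rw [eval_eq]
  rw [Finset.sum_eq_single (Finsupp.single i e)]
  · rw [Finset.prod_eq_one, mul_one]
    intro k hk
    by_cases h : k = i
    · subst h; simp
    · simp [Ne.symm h]
  · intro m hm hne
    have hdeg := hG (mem_support_iff.1 hm)
    have : ∃ k, k ≠ i ∧ m k ≠ 0 := by
      by_contra hcon
      push Not at hcon
      apply hne
      have h1 : m = Finsupp.single i (m i) := by
        ext k
        by_cases h : k = i
        · subst h; simp
        · simp [Ne.symm h, hcon k h]
      rw [h1] at hdeg ⊢
      simp [Finsupp.weight_single] at hdeg
      simp [hdeg]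
    obtain ⟨k, hk, hmk⟩ := this
    rw [Finset.prod_eq_zero (i := k) (by simpa using hmk) (by simp [hk, hmk]), mul_zero]
  · intro h
    rw [notMem_support_iff.1 h, zero_mul]

lemma nonsing_monomial {F : MvPolynomial (Fin 3) K} {d : ℕ}
    (hF : F.IsHomogeneous d) (hns : IsNonsingular F) (i : Fin 3) :
    ∃ j, coeff (Finsupp.single i (d - 1) + Finsupp.single j 1) F ≠ 0 := by
  by_contra hcon
  push Not at hcon
  have h := hns (Pi.single i 1) (fun j => by
    rw [eval_single_of_homog hF.pderiv i, coeff_pderiv, hcon j, zero_mul])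
  have := congrFun h i
  simp at this

lemma coeff_dg (t : Fin 3 → Kˣ) (F : MvPolynomial (Fin 3) K) (m : Fin 3 →₀ ℕ) :
    coeff m (substPoly (dg t : Matrix (Fin 3) (Fin 3) K) F) =
      ((t 0 ^ m 0 * t 1 ^ m 1 * t 2 ^ m 2 : Kˣ) : K) * coeff m F := by
  induction F using MvPolynomial.induction_on' with
  | monomial u a =>
    have : substPoly (dg t : Matrix (Fin 3) (Fin 3) K) (monomial u a) =
        monomial u (a * ((t 0 ^ u 0 * t 1 ^ u 1 * t 2 ^ u 2 : Kˣ) : K)) := by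
      rw [substPoly, aeval_monomial, monomial_eq, Finsupp.prod_fintype _ _ (by simp),
        Finsupp.prod_fintype _ _ (by simp)]
      simp only [dg_val, Matrix.diagonal_apply, ite_smul, zero_smul, Finset.sum_ite_eq,
        Finset.mem_univ, if_true, Fin.prod_univ_three, MvPolynomial.smul_eq_C_mul, mul_pow,
        Units.val_mul, Units.val_pow_eq_pow_val, C_mul, C_pow, algebraMap_eq]
      ring
    rw [this, coeff_monomial, coeff_monomial]
    split_ifs with h
    · subst h; ring
    · simp
  | add p q hp hq => rw [substPoly_add, coeff_add, coeff_add, hp, hq, mul_add]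

lemma normal_forms : ∀ f : Fin 3 → Fin 3, ∃ σ : Equiv.Perm (Fin 3),
    (f (σ 0) = σ 0 ∧ f (σ 1) = σ 1 ∧ f (σ 2) = σ 2) ∨
    (f (σ 0) = σ 0 ∧ f (σ 1) = σ 1 ∧ f (σ 2) = σ 0) ∨
    (f (σ 0) = σ 0 ∧ f (σ 1) = σ 0 ∧ f (σ 2) = σ 0) ∨
    (f (σ 0) = σ 0 ∧ f (σ 1) = σ 0 ∧ f (σ 2) = σ 1) ∨
    (f (σ 0) = σ 0 ∧ f (σ 1) = σ 2 ∧ f (σ 2) = σ 1) ∨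
    (f (σ 0) = σ 1 ∧ f (σ 1) = σ 0 ∧ f (σ 2) = σ 0) ∨
    (f (σ 0) = σ 1 ∧ f (σ 1) = σ 2 ∧ f (σ 2) = σ 0) := by decide

lemma shape {M : Type*} [AddCommGroup M] (x : Fin 3 → M) (l : M) (f : Fin 3 → Fin 3) (D : ℤ)
    (hD : 4 ≤ D) (h : ∀ i, (D - 1) • x i + x (f i) = l)
    (hord : ∀ N : ℤ, ∀ σ : Equiv.Perm (Fin 3), N • (x (σ 0) - x (σ 1)) = 0 →
      N • (x (σ 0) - x (σ 2)) = 0 → D * (D - 1) ∣ N) :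
    ∃ σ : Equiv.Perm (Fin 3), f (σ 0) = σ 0 ∧ f (σ 1) = σ 1 ∧ f (σ 2) = σ 0 := by
  obtain ⟨σ, hσ⟩ := normal_forms f
  have g0 := h (σ 0)
  have g1 := h (σ 1)
  have g2 := h (σ 2)
  have ho := fun N => hord N σ
  rcases hσ with ⟨e0, e1, e2⟩ | ⟨e0, e1, e2⟩ | ⟨e0, e1, e2⟩ | ⟨e0, e1, e2⟩ | ⟨e0, e1, e2⟩ |
    ⟨e0, e1, e2⟩ | ⟨e0, e1, e2⟩
  · rw [e0] at g0; rw [e1] at g1; rw [e2] at g2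
    have := ho D (by linear_combination (norm := module) g0 - g1)
      (by linear_combination (norm := module) g0 - g2)
    have := Int.le_of_dvd (by linarith) this
    nlinarith
  · exact ⟨σ, e0, e1, e2⟩
  · rw [e0] at g0; rw [e1] at g1; rw [e2] at g2
    have := ho (D - 1) (by linear_combination (norm := module) g0 - g1)
      (by linear_combination (norm := module) g0 - g2)
    have := Int.le_of_dvd (by linarith) this
    nlinarith
  · rw [e0] at g0; rw [e1] at g1; rw [e2] at g2
    have := ho ((D - 1) * (D - 1)) (by linear_combination (norm := module) (D - 1) • (g0 - g1))
      (by linear_combination (norm := module) (D - 1) • (g0 - g2) - (g0 - g1))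
    have := Int.le_of_dvd (by nlinarith) this
    nlinarith
  · rw [e0] at g0; rw [e1] at g1; rw [e2] at g2
    have := ho (D * (D - 2))
      (by linear_combination (norm := module) (g2 - g0) - (D - 1) • (g1 - g0))
      (by linear_combination (norm := module) (g1 - g0) - (D - 1) • (g2 - g0))
    have := Int.le_of_dvd (by nlinarith) this
    nlinarith
  · rw [e0] at g0; rw [e1] at g1; rw [e2] at g2
    have := ho ((D - 1) * (D - 2))
      (by linear_combination (norm := module) (1 - D) • (g1 - g0))
      (by linear_combination (norm := module) (2 - D) • (g2 - g0) - (g1 - g0))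
    have := Int.le_of_dvd (by nlinarith) this
    nlinarith
  · rw [e0] at g0; rw [e1] at g1; rw [e2] at g2
    have := ho ((D - 1) * (D - 2) + 1)
      (by linear_combination (norm := module) (1 - D) • (g1 - g0) + (g2 - g0))
      (by linear_combination (norm := module) (2 - D) • (g2 - g0) - (g1 - g0))
    have := Int.le_of_dvd (by nlinarith) this
    nlinarith

end cases

section forward

/-- scaled permutation matrix -/
def permGL (σ : Equiv.Perm (Fin 3)) (s : Fin 3 → Kˣ) : GL (Fin 3) K where
  val := Matrix.of fun i j => if i = σ j then (s j : K) else 0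
  inv := Matrix.of fun j i => if i = σ j then ((s j)⁻¹ : K) else 0
  val_inv := by
    ext i j
    obtain ⟨i, rfl⟩ := σ.surjective i
    obtain ⟨j, rfl⟩ := σ.surjective j
    by_cases h : i = j
    · subst h; simp [Matrix.mul_apply]
    · simp [Matrix.mul_apply, Matrix.one_apply, h, Ne.symm h]
  inv_val := by
    ext i j
    by_cases h : i = j
    · subst h; simp [Matrix.mul_apply]
    · simp [Matrix.mul_apply, h, Ne.symm h]

lemma subst_permGL (σ : Equiv.Perm (Fin 3)) (s : Fin 3 → Kˣ) (i : Fin 3) :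
    substPoly (permGL σ s : Matrix (Fin 3) (Fin 3) K) (X (σ i)) = C (s i : K) * X i := by
  rw [substPoly_X]
  simp [permGL, MvPolynomial.smul_eq_C_mul]

lemma degree_perm (σ : Equiv.Perm (Fin 3)) (m : Fin 3 →₀ ℕ) :
    m.degree = m (σ 0) + m (σ 1) + m (σ 2) := by
  rw [Finsupp.degree_eq_sum, ← Equiv.sum_comp σ, Fin.sum_univ_three]

lemma finsupp_eq_perm (σ : Equiv.Perm (Fin 3)) (m m' : Fin 3 →₀ ℕ) (h0 : m (σ 0) = m' (σ 0))
    (h1 : m (σ 1) = m' (σ 1)) (h2 : m (σ 2) = m' (σ 2)) : m = m' := by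
  ext i
  obtain ⟨i, rfl⟩ := σ.surjective i
  fin_cases i
  · exact h0
  · exact h1
  · exact h2

lemma forward_diag [IsAlgClosed K] [CharZero K] (d : ℕ) (hd : 4 ≤ d) (F : MvPolynomial (Fin 3) K)
    (hF : F.IsHomogeneous d) (hns : IsNonsingular F) (t : Fin 3 → Kˣ)
    (ht : dg t ∈ autGL F)
    (hord : ∀ N : ℤ, (t 1 / t 0) ^ N = 1 → (t 2 / t 0) ^ N = 1 → ((d * (d - 1) : ℕ) : ℤ) ∣ N) :
    ∃ α : K, α ≠ 0 ∧ ProjEquiv F (X 0 ^ d + X 1 ^ d + C α * X 0 * X 2 ^ (d - 1)) := by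
  obtain ⟨l, hl⟩ := ht
  have hDD : ((d * (d - 1) : ℕ) : ℤ) = (d : ℤ) * ((d : ℤ) - 1) := by
    rw [Nat.cast_mul, Nat.cast_sub (by omega), Nat.cast_one]
  have hmon : ∀ m : Fin 3 →₀ ℕ, coeff m F ≠ 0 → ∏ i, t i ^ m i = l := by
    intro m hm
    have := congrArg (coeff m) hl
    rw [coeff_dg, coeff_smul, smul_eq_mul] at this
    rw [Fin.prod_univ_three]
    exact Units.ext (mul_right_cancel₀ hm this)
  choose f hf using nonsing_monomial hF hns
  have hf' : ∀ i, t i ^ (d - 1) * t (f i) = l := by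
    intro i
    rw [← hmon _ (hf i)]
    simp only [Finsupp.add_apply, pow_add, Finset.prod_mul_distrib]
    congr 1
    · rw [Finset.prod_eq_single i] <;> simp +contextual [Finsupp.single_apply, eq_comm]
    · rw [Finset.prod_eq_single (f i)] <;> simp +contextual [Finsupp.single_apply, eq_comm]
  have hord' : ∀ N : ℤ, ∀ σ : Equiv.Perm (Fin 3), (t (σ 0) / t (σ 1)) ^ N = 1 →
      (t (σ 0) / t (σ 2)) ^ N = 1 → ((d * (d - 1) : ℕ) : ℤ) ∣ N := by
    intro N σ h1 h2
    have h3 : ∀ i, t (σ i) ^ N = t (σ 0) ^ N := by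
      intro i
      fin_cases i
      · rfl
      · rw [div_zpow, div_eq_one] at h1; exact h1.symm
      · rw [div_zpow, div_eq_one] at h2; exact h2.symm
    have h4 : ∀ i, t i ^ N = t (σ 0) ^ N := fun i => by
      obtain ⟨i, rfl⟩ := σ.surjective i; exact h3 i
    apply hord N
    · rw [div_zpow, div_eq_one, h4, h4 0]
    · rw [div_zpow, div_eq_one, h4, h4 0]
  obtain ⟨σ, e0, e1, e2⟩ := shape (M := Additive Kˣ) (fun i => Additive.ofMul (t i))
    (Additive.ofMul l) f (d : ℤ) (by exact_mod_cast hd)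
    (fun i => by
      apply Additive.toMul.injective
      have : ((d : ℤ) - 1) = ((d - 1 : ℕ) : ℤ) := by
        rw [Nat.cast_sub (by omega), Nat.cast_one]
      rw [this]
      simpa using hf' i)
    (fun N σ h1 h2 => by
      rw [← hDD]
      exact hord' N σ (congrArg Additive.toMul h1) (congrArg Additive.toMul h2))
  have g0 := hf' (σ 0)
  have g1 := hf' (σ 1)
  have g2 := hf' (σ 2)
  have k0 := hf (σ 0)
  have k1 := hf (σ 1)
  have k2 := hf (σ 2)
  rw [e0] at g0 k0
  rw [e1] at g1 k1
  rw [e2] at g2 k2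
  have hd1 : d - 1 + 1 = d := by omega
  rw [← Finsupp.single_add, hd1] at k0 k1
  rw [← pow_succ, hd1] at g0 g1
  set p := t (σ 0) with hp
  obtain ⟨ζ, hζ⟩ : ∃ ζ, t (σ 1) = p * ζ := ⟨t (σ 1) / p, by simp⟩
  obtain ⟨η, hη⟩ : ∃ η, t (σ 2) = p * η := ⟨t (σ 2) / p, by simp⟩
  have hζd : ζ ^ d = 1 := by
    rw [hζ, mul_pow, g0] at g1
    simpa using g1
  have hηd : η ^ (d - 1) = 1 := by
    rw [hη, mul_pow, mul_right_comm, ← pow_succ, hd1, g0] at g2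
    simpa using g2
  have hord2 : ∀ N : ℕ, ζ ^ N = 1 → η ^ N = 1 → d * (d - 1) ∣ N := by
    intro N h1 h2
    have := hord' N σ (by rw [← hp, hζ, zpow_natCast, div_pow, mul_pow, h1]; simp)
      (by rw [← hp, hη, zpow_natCast, div_pow, mul_pow, h2]; simp)
    exact_mod_cast this
  have n01 : σ 0 ≠ σ 1 := by simp
  have n02 : σ 0 ≠ σ 2 := by simp
  have n12 : σ 1 ≠ σ 2 := by simp
  -- classification of monomials
  have hclass : ∀ m, coeff m F ≠ 0 → m = Finsupp.single (σ 0) d ∨ m = Finsupp.single (σ 1) d ∨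
      m = Finsupp.single (σ 2) (d - 1) + Finsupp.single (σ 0) 1 := by
    intro m hm
    have hdeg : m (σ 0) + m (σ 1) + m (σ 2) = d := by
      rw [← degree_perm]
      have := hF hm
      rw [Finsupp.degree_eq_weight_one]
      exact this
    have h1 := hmon m hm
    rw [← Equiv.prod_comp σ, Fin.prod_univ_three, ← hp, hζ, hη, mul_pow, mul_pow, ← g0] at h1
    have h2 : ζ ^ m (σ 1) * η ^ m (σ 2) = 1 := by
      have : p ^ d * (ζ ^ m (σ 1) * η ^ m (σ 2)) = p ^ d := by
        refine Eq.trans ?_ h1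
        rw [← hdeg, pow_add, pow_add]
        simp only [mul_comm, mul_left_comm, mul_assoc]
      simpa using this
    have h3 : d ∣ m (σ 1) := by
      have := hord2 (m (σ 1) * (d - 1)) (by
        have := congrArg (· ^ (d - 1)) h2
        simp only [mul_pow, one_pow, ← pow_mul] at this
        rwa [mul_comm (m (σ 2)), pow_mul η, hηd, one_pow, mul_one] at this)
        (by rw [mul_comm, pow_mul, hηd, one_pow])
      exact Nat.dvd_of_mul_dvd_mul_right (by omega) this
    have h4 : d - 1 ∣ m (σ 2) := by
      have := hord2 (d * m (σ 2)) (by rw [pow_mul, hζd, one_pow]) (by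
        have := congrArg (· ^ d) h2
        simp only [mul_pow, one_pow, ← pow_mul] at this
        rwa [mul_comm (m (σ 1)), pow_mul ζ, hζd, one_pow, one_mul, mul_comm] at this)
      exact Nat.dvd_of_mul_dvd_mul_left (by omega) this
    obtain ⟨a, ha⟩ := h3
    obtain ⟨b, hb⟩ := h4
    have ha' : a = 0 ∨ a = 1 := by
      by_contra hcon
      have : 2 ≤ a := by omega
      have : d * 2 ≤ d * a := Nat.mul_le_mul_left _ this
      omega
    have hb' : b = 0 ∨ b = 1 := by
      by_contra hcon
      have : 2 ≤ b := by omega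
      have : (d - 1) * 2 ≤ (d - 1) * b := Nat.mul_le_mul_left _ this
      omega
    rcases ha' with rfl | rfl
    · rcases hb' with rfl | rfl
      · left
        apply finsupp_eq_perm σ <;> simp <;> omega
      · right; right
        apply finsupp_eq_perm σ <;> simp [n02, n12] <;> omega
    · right; left
      apply finsupp_eq_perm σ <;> simp <;> omega
  set u := coeff (Finsupp.single (σ 0) d) F with hu
  set v := coeff (Finsupp.single (σ 1) d) F with hv
  set w := coeff (Finsupp.single (σ 2) (d - 1) + Finsupp.single (σ 0) 1) F with hw
  have hFeq : F = C u * X (σ 0) ^ d + C v * X (σ 1) ^ d +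
      C w * (X (σ 2) ^ (d - 1) * X (σ 0)) := by
    have m12 : Finsupp.single (σ 0) d ≠ Finsupp.single (σ 1) d := by
      intro h; have := DFunLike.congr_fun h (σ 0); simp at this; omega
    have m13 : Finsupp.single (σ 0) d ≠ Finsupp.single (σ 2) (d - 1) + Finsupp.single (σ 0) 1 := by
      intro h; have := DFunLike.congr_fun h (σ 2); simp at this; omega
    have m23 : Finsupp.single (σ 1) d ≠ Finsupp.single (σ 2) (d - 1) + Finsupp.single (σ 0) 1 := by
      intro h; have := DFunLike.congr_fun h (σ 0); simp at this
    have r1 : C u * X (σ 0) ^ d = monomial (Finsupp.single (σ 0) d) u := by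
      rw [X_pow_eq_monomial, C_mul_monomial, mul_one]
    have r2 : C v * X (σ 1) ^ d = monomial (Finsupp.single (σ 1) d) v := by
      rw [X_pow_eq_monomial, C_mul_monomial, mul_one]
    have r3 : C w * (X (σ 2) ^ (d - 1) * X (σ 0)) =
        monomial (Finsupp.single (σ 2) (d - 1) + Finsupp.single (σ 0) 1) w := by
      rw [X_pow_eq_monomial, X, monomial_mul, C_mul_monomial, mul_one, mul_one]
    rw [r1, r2, r3]
    ext m
    rw [coeff_add, coeff_add, coeff_monomial, coeff_monomial, coeff_monomial]
    by_cases hm : coeff m F = 0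
    · rw [hm]
      have a1 : Finsupp.single (σ 0) d ≠ m := by rintro rfl; exact k0 hm
      have a2 : Finsupp.single (σ 1) d ≠ m := by rintro rfl; exact k1 hm
      have a3 : Finsupp.single (σ 2) (d - 1) + Finsupp.single (σ 0) 1 ≠ m := by
        rintro rfl; exact k2 hm
      simp only [a1, a2, a3, if_false, add_zero]
    · rcases hclass m hm with rfl | rfl | rfl
      · simp only [if_true, m12.symm, m13.symm, if_false, add_zero]; rfl
      · simp only [if_true, m12, m23.symm, if_false, add_zero, zero_add]; rfl
      · simp only [if_true, m13, m23, if_false, zero_add]; rfl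
  obtain ⟨s0, hs0⟩ := IsAlgClosed.exists_pow_nat_eq (u⁻¹) (n := d) (by omega)
  obtain ⟨s1, hs1⟩ := IsAlgClosed.exists_pow_nat_eq (v⁻¹) (n := d) (by omega)
  have hs0' : s0 ≠ 0 := by
    rintro rfl; rw [zero_pow (by omega)] at hs0; exact inv_ne_zero k0 hs0.symm
  have hs1' : s1 ≠ 0 := by
    rintro rfl; rw [zero_pow (by omega)] at hs1; exact inv_ne_zero k1 hs1.symm
  refine ⟨w * s0, mul_ne_zero k2 hs0', permGL σ ![Units.mk0 s0 hs0', Units.mk0 s1 hs1', 1], 1, ?_⟩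
  rw [hFeq]
  simp only [substPoly_add, substPoly_pmul, substPoly_pow, substPoly_C, subst_permGL]
  simp only [mul_pow, ← C_pow, ← mul_assoc, ← C_mul]
  simp only [Matrix.cons_val_zero, Matrix.cons_val_one, Units.val_mk0, hs0, hs1, Matrix.cons_val,
    Units.val_one, one_smul, one_pow]
  rw [mul_inv_cancel₀ k0, mul_inv_cancel₀ k1]
  simp only [C_mul, C_1]
  ring

lemma forward [IsAlgClosed K] [CharZero K] (d : ℕ) (hd : 4 ≤ d) (F : MvPolynomial (Fin 3) K)
    (hF : F.IsHomogeneous d) (hns : IsNonsingular F) 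
    (h : ∃ g ∈ projAut F, orderOf g = d * (d - 1)) :
    ∃ α : K, α ≠ 0 ∧ ProjEquiv F (X 0 ^ d + X 1 ^ d + C α * X 0 * X 2 ^ (d - 1)) := by
  obtain ⟨g, ⟨A, hA, rfl⟩, hg⟩ := h
  have hn : 0 < d * (d - 1) := Nat.mul_pos (by omega) (by omega)
  have hAn : A ^ (d * (d - 1)) ∈ Subgroup.center (GL (Fin 3) K) := by
    rw [← QuotientGroup.eq_one_iff, ← hg]
    exact pow_orderOf_eq_one (QuotientGroup.mk' (Subgroup.center (GL (Fin 3) K)) A)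
  obtain ⟨B, t, rfl⟩ := exists_diag A _ hn hAn
  set G := substPoly (B : Matrix (Fin 3) (Fin 3) K) F with hG
  have ht : dg t ∈ autGL G := (autGL_conj (F := F) (G := G) B 1 (by simp [hG]) _).1 hA
  obtain ⟨α, hα, M, c, hM⟩ := forward_diag d hd G (homog_subst _ _ _ hF) (nonsing_subst B F hns) t ht
    (by
      intro N h1 h2
      have h3 : (dg t) ^ N ∈ Subgroup.center (GL (Fin 3) K) := by
        rw [← map_zpow, dg_mem_center]
        rw [div_zpow, div_eq_one] at h1 h2
        exact ⟨h1, h2⟩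
      rw [← hg, orderOf_dvd_iff_zpow_eq_one, ← map_zpow, conj_zpow, QuotientGroup.mk'_apply,
        QuotientGroup.eq_one_iff]
      exact Subgroup.Normal.conj_mem inferInstance _ h3 B)
  refine ⟨α, hα, B * M, c, ?_⟩
  rw [Units.val_mul, substPoly_mul]
  exact hM

end forward

section backward

lemma model_gen [IsAlgClosed K] [CharZero K] (d : ℕ) (hd : 4 ≤ d) :
    ∃ t : Fin 3 → Kˣ, t 0 = 1 ∧ IsPrimitiveRoot (t 1) d ∧ IsPrimitiveRoot (t 2) (d - 1) := by
  have h : ∀ n : ℕ, 0 < n → ∃ ζ : Kˣ, IsPrimitiveRoot ζ n := by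
    intro n hn
    have : NeZero (n : K) := ⟨by exact_mod_cast hn.ne'⟩
    have : NeZero n := ⟨hn.ne'⟩
    obtain ⟨ζ, hζ⟩ := HasEnoughRootsOfUnity.exists_primitiveRoot K n
    exact ⟨(hζ.isUnit hn.ne').unit, hζ.isUnit_unit hn.ne'⟩
  obtain ⟨ζ, hζ⟩ := h d (by omega)
  obtain ⟨η, hη⟩ := h (d - 1) (by omega)
  exact ⟨![1, ζ, η], rfl, hζ, hη⟩

lemma model_gen_mem (d : ℕ) (hd : 4 ≤ d) (α : K) (t : Fin 3 → Kˣ) (h0 : t 0 = 1)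
    (h1 : IsPrimitiveRoot (t 1) d) (h2 : IsPrimitiveRoot (t 2) (d - 1)) :
    dg t ∈ autGL (X 0 ^ d + X 1 ^ d + C α * X 0 * X 2 ^ (d - 1)) := by
  refine ⟨1, ?_⟩
  have hX : ∀ i, substPoly (dg t : Matrix (Fin 3) (Fin 3) K) (X i) = C (t i : K) * X i := by
    intro i
    rw [substPoly_X]
    simp [dg_val, Matrix.diagonal_apply, MvPolynomial.smul_eq_C_mul]
  have e1 := h1.pow_eq_one
  have e2 := h2.pow_eq_one
  rw [Units.ext_iff, Units.val_pow_eq_pow_val, Units.val_one] at e1 e2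
  simp only [substPoly_add, substPoly_pmul, substPoly_pow, substPoly_C, hX, mul_pow, ← C_pow, e1,
    e2, h0]
  simp

lemma model_gen_order (d : ℕ) (hd : 4 ≤ d) (t : Fin 3 → Kˣ) (h0 : t 0 = 1)
    (h1 : IsPrimitiveRoot (t 1) d) (h2 : IsPrimitiveRoot (t 2) (d - 1)) :
    orderOf (QuotientGroup.mk' (Subgroup.center (GL (Fin 3) K)) (dg t)) = d * (d - 1) := by
  have key : ∀ N : ℕ, (QuotientGroup.mk' (Subgroup.center (GL (Fin 3) K)) (dg t)) ^ N = 1 ↔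
      t 1 ^ N = 1 ∧ t 2 ^ N = 1 := by
    intro N
    rw [← map_pow, QuotientGroup.mk'_apply, QuotientGroup.eq_one_iff, ← map_pow, dg_mem_center]
    simp [h0]
  apply Nat.dvd_antisymm
  · apply orderOf_dvd_of_pow_eq_one
    rw [key, pow_mul, h1.pow_eq_one, one_pow, mul_comm, pow_mul, h2.pow_eq_one, one_pow]
    exact ⟨rfl, rfl⟩
  · obtain ⟨a, b⟩ := (key _).1 (pow_orderOf_eq_one _)
    apply Nat.Coprime.mul_dvd_of_dvd_of_dvd _ (h1.dvd_of_pow_eq_one _ a) (h2.dvd_of_pow_eq_one _ b)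
    have : d = (d - 1) + 1 := by omega
    rw [this]; simp

lemma backward [IsAlgClosed K] [CharZero K] (d : ℕ) (hd : 4 ≤ d) (F : MvPolynomial (Fin 3) K)
    (α : K) (h : ProjEquiv F (X 0 ^ d + X 1 ^ d + C α * X 0 * X 2 ^ (d - 1))) :
    ∃ g ∈ projAut F, orderOf g = d * (d - 1) := by
  obtain ⟨B, c, hB⟩ := h
  obtain ⟨t, h0, h1, h2⟩ := model_gen (K := K) d hd
  refine ⟨QuotientGroup.mk' _ (B * dg t * B⁻¹),
    ⟨_, (autGL_conj B c hB (dg t)).2 (model_gen_mem d hd α t h0 h1 h2), rfl⟩, ?_⟩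
  rw [← model_gen_order d hd t h0 h1 h2]
  symm
  apply SemiconjBy.orderOf_eq (QuotientGroup.mk' _ B)
  rw [SemiconjBy, ← map_mul, ← map_mul]
  simp

end backward

section hessian

/-- the Hessian matrix -/
def hessM (F : MvPolynomial (Fin 3) K) : Matrix (Fin 3) (Fin 3) (MvPolynomial (Fin 3) K) :=
  Matrix.of fun i j => pderiv i (pderiv j F)

lemma hess_subst (A : GL (Fin 3) K) (F : MvPolynomial (Fin 3) K) :
    (hessM (substPoly (A : Matrix (Fin 3) (Fin 3) K) F)).det =
      C ((A : Matrix (Fin 3) (Fin 3) K).det ^ 2) *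
        substPoly (A : Matrix (Fin 3) (Fin 3) K) (hessM F).det := by
  have h1 : hessM (substPoly (A : Matrix (Fin 3) (Fin 3) K) F) =
      ((A : Matrix (Fin 3) (Fin 3) K).map C)ᵀ * (hessM F).map (substEquiv A).toRingHom *
        ((A : Matrix (Fin 3) (Fin 3) K).map C) := by
    ext1 i j
    simp only [hessM, Matrix.of_apply, pderiv_substPoly, map_sum, Derivation.map_smul,
      Finset.smul_sum]
    simp only [Matrix.mul_apply, Matrix.transpose_apply, Matrix.map_apply, Matrix.of_apply,
      MvPolynomial.smul_eq_C_mul, Finset.sum_mul]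
    refine Finset.sum_congr rfl fun k _ => Finset.sum_congr rfl fun l _ => ?_
    change _ = C _ * substPoly _ _ * _
    ring
  rw [h1, Matrix.det_mul, Matrix.det_mul, Matrix.det_transpose]
  have h2 : ((A : Matrix (Fin 3) (Fin 3) K).map C).det =
      (C (A : Matrix (Fin 3) (Fin 3) K).det : MvPolynomial (Fin 3) K) := 
    (RingHom.map_det C _).symm
  have h3 : ((hessM F).map (substEquiv A).toRingHom).det = substPoly _ (hessM F).det :=
    (RingHom.map_det (substEquiv A).toRingHom _).symm
  rw [h2, h3, C_pow]
  ring

lemma hess_smul (c : K) (F : MvPolynomial (Fin 3) K) :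
    (hessM (c • F)).det = C (c ^ 3) * (hessM F).det := by
  have : hessM (c • F) = (C c : MvPolynomial (Fin 3) K) • hessM F := by
    ext1 i j
    simp [hessM, MvPolynomial.smul_eq_C_mul]
  rw [this, Matrix.det_smul]
  simp

lemma pderiv_X_pow_self (i : Fin 3) (n : ℕ) :
    pderiv i (X i ^ (n + 1) : MvPolynomial (Fin 3) K) = C ((n : K) + 1) * X i ^ n := by
  rw [pderiv_pow, pderiv_X_self]
  simp

lemma pderiv_X_pow_ne (i j : Fin 3) (h : j ≠ i) (n : ℕ) :
    pderiv i (X j ^ n : MvPolynomial (Fin 3) K) = 0 := by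
  rw [pderiv_pow, pderiv_X_of_ne h]
  simp

lemma hess_model (e : ℕ) (α : K) :
    (hessM (X 0 ^ (e + 3) + X 1 ^ (e + 3) + C α * X 0 * X 2 ^ (e + 2) : MvPolynomial (Fin 3) K)).det
      = X 1 ^ (e + 1) * (X 2 ^ e *
        (C (((e : K) + 3) ^ 2 * (e + 2) ^ 3 * (e + 1) * α) * X 0 ^ (e + 2) -
          C (((e : K) + 3) * (e + 2) ^ 3 * α ^ 2) * X 2 ^ (e + 2))) := by
  rw [Matrix.det_fin_three]
  have c3 : ∀ n : ℕ, (C ((n : K)) : MvPolynomial (Fin 3) K) = (n : MvPolynomial (Fin 3) K) :=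
    fun n => map_natCast C n
  have a0 : pderiv (0 : Fin 3) (X 0 : MvPolynomial (Fin 3) K) = 1 := pderiv_X_self 0
  have a1 : pderiv (1 : Fin 3) (X 0 : MvPolynomial (Fin 3) K) = 0 := pderiv_X_of_ne (by decide)
  have a2 : pderiv (2 : Fin 3) (X 0 : MvPolynomial (Fin 3) K) = 0 := pderiv_X_of_ne (by decide)
  simp only [hessM, Matrix.of_apply, map_add, pderiv_mul, pderiv_C, pderiv_one, pderiv_X_pow_self,
    pderiv_X_pow_ne (0 : Fin 3) 1 (by decide), pderiv_X_pow_ne (0 : Fin 3) 2 (by decide),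
    pderiv_X_pow_ne (1 : Fin 3) 0 (by decide), pderiv_X_pow_ne (1 : Fin 3) 2 (by decide),
    pderiv_X_pow_ne (2 : Fin 3) 0 (by decide), pderiv_X_pow_ne (2 : Fin 3) 1 (by decide),
    a0, a1, a2, map_zero, mul_zero, zero_mul, add_zero, zero_add, map_one, mul_one, sub_zero,
    show e + 3 = (e + 2) + 1 from rfl, show e + 2 = (e + 1) + 1 from rfl]
  push_cast
  simp only [map_mul, map_add, map_pow, map_one, c3, map_ofNat]
  ring

end hessian


section sqfree
variable [CharZero K]


lemma prime_not_dvd_C (q : MvPolynomial (Fin 3) K) (hq : Prime q) (a : K) (ha : a ≠ 0) :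
    ¬ q ∣ C a := fun h =>
  hq.not_isUnit (isUnit_of_dvd_unit h ((IsUnit.mk0 a ha).map (C : K →+* _)))

lemma X_prime' (i : Fin 3) : Prime (X i : MvPolynomial (Fin 3) K) := X_prime

lemma X_not_dvd (i j : Fin 3) (h : i ≠ j) : ¬ (X i : MvPolynomial (Fin 3) K) ∣ X j := by
  rw [MvPolynomial.X_dvd_X]; exact h

lemma P_not_both (n : ℕ) (hn : n ≠ 0) (a b : K) (ha : a ≠ 0) (q : MvPolynomial (Fin 3) K)
    (hq : Prime q) (h2 : q ∣ X 2) (hP : q ∣ C a * X 0 ^ n - C b * X 2 ^ n) : False := by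
  have h3 : q ∣ C a * X 0 ^ n := by
    have := dvd_add hP ((dvd_pow h2 hn).mul_left (C b))
    rwa [sub_add_cancel] at this
  have h0 : q ∣ X 0 := by
    rcases hq.dvd_or_dvd h3 with h | h
    · exact absurd h (prime_not_dvd_C q hq a ha)
    · exact hq.dvd_of_dvd_pow h
  have h4 := (hq.dvd_prime_iff_associated (X_prime' 2)).1 h2
  exact X_not_dvd 2 0 (by decide) (h4.symm.dvd.trans h0)

lemma P_sqfree (n : ℕ) (a b : K) (ha : a ≠ 0) (hb : b ≠ 0) (q : MvPolynomial (Fin 3) K)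
    (hq : Prime q) (hP : q ^ 2 ∣ C a * X 0 ^ (n + 1) - C b * X 2 ^ (n + 1)) : False := by
  have hq1 : q ∣ C a * X 0 ^ (n + 1) - C b * X 2 ^ (n + 1) := (dvd_pow_self q two_ne_zero).trans hP
  have hd : q ∣ C a * (C ((n : K) + 1) * X 0 ^ n) := by
    obtain ⟨r, hr⟩ := hP
    have := congrArg (pderiv (0 : Fin 3)) hr
    rw [map_sub, pderiv_C_mul, pderiv_C_mul, pderiv_X_pow_self, pderiv_X_pow_ne _ _ (by decide),
      pderiv_mul, pderiv_pow] at this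
    simp only [mul_zero, sub_zero] at this
    rw [this]
    refine ⟨2 * pderiv 0 q * r + q * pderiv 0 r, ?_⟩
    push_cast
    ring
  have h0 : q ∣ X 0 := by
    rcases hq.dvd_or_dvd hd with h | h
    · exact absurd h (prime_not_dvd_C q hq a ha)
    rcases hq.dvd_or_dvd h with h | h
    · exact absurd h (prime_not_dvd_C q hq _ (by exact_mod_cast Nat.succ_ne_zero n))
    · exact hq.dvd_of_dvd_pow h
  have h3 : q ∣ C b * X 2 ^ (n + 1) := by
    have := dvd_sub ((dvd_pow h0 (Nat.succ_ne_zero n)).mul_left (C a)) hq1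
    rwa [sub_sub_cancel] at this
  have h2 : q ∣ X 2 := by
    rcases hq.dvd_or_dvd h3 with h | h
    · exact absurd h (prime_not_dvd_C q hq b hb)
    · exact hq.dvd_of_dvd_pow h
  exact P_not_both (n + 1) (Nat.succ_ne_zero n) a b ha q hq h2 hq1

lemma lem1 (e : ℕ) (he : 2 ≤ e) (a b : K) (ha : a ≠ 0) (hb : b ≠ 0) (q : MvPolynomial (Fin 3) K)
    (hq : Prime q)
    (h : q ^ (e + 1) ∣ X 1 ^ (e + 1) * (X 2 ^ e * (C a * X 0 ^ (e + 2) - C b * X 2 ^ (e + 2)))) :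
    q ∣ X 1 := by
  by_contra h1
  have h' := hq.pow_dvd_of_dvd_mul_left _ (fun hh => h1 (hq.dvd_of_dvd_pow hh)) h
  by_cases h2 : q ∣ X 2
  · have h3 := hq.pow_dvd_of_dvd_mul_right _
      (fun hh => P_not_both (e + 2) (by omega) a b ha q hq h2 hh) h'
    have h4 := (hq.dvd_prime_iff_associated (X_prime' 2)).1 h2
    have h5 := (pow_dvd_pow_of_dvd h4.symm.dvd (e + 1)).trans h3
    rw [pow_dvd_pow_iff (X_prime' 2).ne_zero (X_prime' 2).not_isUnit] at h5
    omega
  · have h3 := hq.pow_dvd_of_dvd_mul_left _ (fun hh => h2 (hq.dvd_of_dvd_pow hh)) h'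
    exact P_sqfree (e + 1) a b ha hb q hq ((pow_dvd_pow q (by omega)).trans h3)

lemma lem2 (e : ℕ) (he : 2 ≤ e) (a b : K) (ha : a ≠ 0) (hb : b ≠ 0) (q : MvPolynomial (Fin 3) K)
    (hq : Prime q)
    (h : q ^ e ∣ X 1 ^ (e + 1) * (X 2 ^ e * (C a * X 0 ^ (e + 2) - C b * X 2 ^ (e + 2)))) :
    q ∣ X 1 ∨ q ∣ X 2 := by
  by_contra! h1
  have h' := hq.pow_dvd_of_dvd_mul_left _ (fun hh => h1.1 (hq.dvd_of_dvd_pow hh)) h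
  have h3 := hq.pow_dvd_of_dvd_mul_left _ (fun hh => h1.2 (hq.dvd_of_dvd_pow hh)) h'
  exact P_sqfree (e + 1) a b ha hb q hq ((pow_dvd_pow q (by omega)).trans h3)

/-- if `X i` divides the `k`-th row form, its other coefficients vanish -/
lemma row_zero (A : Matrix (Fin 3) (Fin 3) K) (i k j : Fin 3) (hij : j ≠ i)
    (h : X i ∣ substPoly A (X k)) : A k j = 0 := by
  obtain ⟨r, hr⟩ := h
  have := congrArg (eval (Pi.single j (1 : K))) hr
  rw [eval_substPoly, eval_mul, eval_X, eval_X, Pi.single_eq_of_ne hij.symm] at this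
  simpa using this

lemma hess_model' (e : ℕ) (α : K) (hα : α ≠ 0) : ∃ a b : K, a ≠ 0 ∧ b ≠ 0 ∧
    (hessM (X 0 ^ (e + 3) + X 1 ^ (e + 3) + C α * X 0 * X 2 ^ (e + 2) : MvPolynomial (Fin 3) K)).det
      = X 1 ^ (e + 1) * (X 2 ^ e * (C a * X 0 ^ (e + 2) - C b * X 2 ^ (e + 2))) := by
  have e1 : ((e : K) + 1) ≠ 0 := by exact_mod_cast Nat.succ_ne_zero e
  have e2 : ((e : K) + 2) ≠ 0 := by exact_mod_cast Nat.succ_ne_zero (e + 1)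
  have e3 : ((e : K) + 3) ≠ 0 := by exact_mod_cast Nat.succ_ne_zero (e + 2)
  exact ⟨_, _, by simp [e1, e2, e3, hα], by simp [e2, e3, hα], hess_model e α⟩

lemma aut_rows (e : ℕ) (he : 2 ≤ e) (α : K) (hα : α ≠ 0) (A : GL (Fin 3) K)
    (hA : A ∈ autGL (X 0 ^ (e + 3) + X 1 ^ (e + 3) + C α * X 0 * X 2 ^ (e + 2) :
      MvPolynomial (Fin 3) K)) :
    (∀ j, j ≠ 1 → A 1 j = 0) ∧ (∀ j, j ≠ 2 → A 2 j = 0) := by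
  obtain ⟨l, hl⟩ := hA
  have hdet : (A : Matrix (Fin 3) (Fin 3) K).det ≠ 0 :=
    (Matrix.isUnit_iff_isUnit_det _).1 A.isUnit |>.ne_zero
  have hh := congrArg (fun G => (hessM G).det) hl
  obtain ⟨a, b, ha, hb, hm⟩ := hess_model' e α hα
  simp only [hess_subst, hess_smul] at hh
  rw [hm] at hh
  set H : MvPolynomial (Fin 3) K :=
    X 1 ^ (e + 1) * (X 2 ^ e * (C a * X 0 ^ (e + 2) - C b * X 2 ^ (e + 2))) with hH
  have hpr : ∀ i : Fin 3, Prime ((substEquiv A).symm (X i)) := fun i =>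
    (MulEquiv.prime_iff (substEquiv A).symm.toMulEquiv).2 (X_prime' i)
  have key : ∀ (i : Fin 3) (m : ℕ), X i ^ m ∣ H → (substEquiv A).symm (X i) ^ m ∣ H := by
    intro i m him
    have : X i ^ m ∣ substEquiv A H := by
      have hu : IsUnit (C ((A : Matrix (Fin 3) (Fin 3) K).det ^ 2) : MvPolynomial (Fin 3) K) :=
        (IsUnit.mk0 _ (pow_ne_zero 2 hdet)).map (C : K →+* _)
      rw [substEquiv_apply, ← hu.dvd_mul_left, hh]
      exact him.mul_left _
    have := map_dvd (substEquiv A).symm this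
    rwa [map_pow, RingEquiv.symm_apply_apply] at this
  have back : ∀ i k : Fin 3, (substEquiv A).symm (X i) ∣ X k →
      X i ∣ substPoly (A : Matrix (Fin 3) (Fin 3) K) (X k) := by
    intro i k h
    have := map_dvd (substEquiv A) h
    rwa [RingEquiv.apply_symm_apply] at this
  have r1 := back 1 1 (lem1 e he a b ha hb _ (hpr 1) (key 1 (e + 1) (dvd_mul_right _ _)))
  have R1 : ∀ j, j ≠ 1 → A 1 j = 0 := fun j hj => row_zero _ 1 1 j hj r1
  refine ⟨R1, ?_⟩
  rcases lem2 e he a b ha hb _ (hpr 2)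
    (key 2 e ((dvd_mul_right _ _).mul_left _)) with h | h
  · exfalso
    have R2 : ∀ j, j ≠ 2 → A 1 j = 0 := fun j hj => row_zero _ 2 1 j hj (back 2 1 h)
    apply hdet
    apply Matrix.det_eq_zero_of_row_eq_zero 1
    intro j
    by_cases hj : j = 1
    · subst hj; exact R2 1 (by decide)
    · exact R1 j hj
  · exact fun j hj => row_zero _ 2 2 j hj (back 2 2 h)

end sqfree


section final
variable [CharZero K]

lemma aut_diag (e : ℕ) (he : 2 ≤ e) (α : K) (hα : α ≠ 0) (A : GL (Fin 3) K)
    (hA : A ∈ autGL (X 0 ^ (e + 3) + X 1 ^ (e + 3) + C α * X 0 * X 2 ^ (e + 2) :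
      MvPolynomial (Fin 3) K)) :
    ∃ t : Fin 3 → Kˣ, A = dg t := by
  obtain ⟨R1, R2⟩ := aut_rows e he α hα A hA
  have hdet : (A : Matrix (Fin 3) (Fin 3) K).det ≠ 0 :=
    (Matrix.isUnit_iff_isUnit_det _).1 A.isUnit |>.ne_zero
  have z10 := R1 0 (by decide)
  have z12 := R1 2 (by decide)
  have z20 := R2 0 (by decide)
  have z21 := R2 1 (by decide)
  have hd3 : (A : Matrix (Fin 3) (Fin 3) K).det = A 0 0 * A 1 1 * A 2 2 := by
    rw [Matrix.det_fin_three, z10, z12, z20, z21]; ring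
  rw [hd3] at hdet
  have n0 : A 0 0 ≠ 0 := fun h => hdet (by rw [h]; ring)
  have n1 : A 1 1 ≠ 0 := fun h => hdet (by rw [h]; ring)
  have n2 : A 2 2 ≠ 0 := fun h => hdet (by rw [h]; ring)
  obtain ⟨l, hl⟩ := hA
  have e3 : ((e : K) + 2 + 1) ≠ 0 := by exact_mod_cast Nat.succ_ne_zero (e + 2)
  have a0 : pderiv (0 : Fin 3) (X 0 : MvPolynomial (Fin 3) K) = 1 := pderiv_X_self 0
  have a1 : pderiv (1 : Fin 3) (X 0 : MvPolynomial (Fin 3) K) = 0 := pderiv_X_of_ne (by decide)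
  have a2 : pderiv (2 : Fin 3) (X 0 : MvPolynomial (Fin 3) K) = 0 := pderiv_X_of_ne (by decide)
  have hv : (A : Matrix (Fin 3) (Fin 3) K) *ᵥ Pi.single 0 1 = ![A 0 0, 0, 0] := by
    ext i
    fin_cases i <;> simp [z10, z20]
  have z0 : ∀ j, j ≠ 0 → A 0 j = 0 := by
    intro j hj
    have h := congrArg (fun G => eval (Pi.single 0 1 : Fin 3 → K) (pderiv j G)) hl
    simp only [pderiv_substPoly, Fin.sum_univ_three, map_add, smul_eval, eval_substPoly, hv,
      Derivation.map_smul] at h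
    have D0 : pderiv (0 : Fin 3) (X 0 ^ (e + 3) + X 1 ^ (e + 3) + C α * X 0 * X 2 ^ (e + 2) :
      MvPolynomial (Fin 3) K) = C (((e + 2 : ℕ) : K) + 1) * X 0 ^ (e + 2) + C α * X 2 ^ (e + 2) := by
      simp only [map_add, pderiv_mul, pderiv_C, pderiv_X_pow_ne (0 : Fin 3) 1 (by decide),
        pderiv_X_pow_ne (0 : Fin 3) 2 (by decide), a0, pderiv_X_pow_self (0 : Fin 3) (e + 2)]
      ring
    have D1 : pderiv (1 : Fin 3) (X 0 ^ (e + 3) + X 1 ^ (e + 3) + C α * X 0 * X 2 ^ (e + 2) :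
      MvPolynomial (Fin 3) K) = C (((e + 2 : ℕ) : K) + 1) * X 1 ^ (e + 2) := by
      simp only [map_add, pderiv_mul, pderiv_C, pderiv_X_pow_ne (1 : Fin 3) 0 (by decide),
        pderiv_X_pow_ne (1 : Fin 3) 2 (by decide), a1, pderiv_X_pow_self (1 : Fin 3) (e + 2)]
      ring
    have D2 : pderiv (2 : Fin 3) (X 0 ^ (e + 3) + X 1 ^ (e + 3) + C α * X 0 * X 2 ^ (e + 2) :
      MvPolynomial (Fin 3) K) = C α * X 0 * (C (((e + 1 : ℕ) : K) + 1) * X 2 ^ (e + 1)) := by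
      simp only [map_add, pderiv_mul, pderiv_C, pderiv_X_pow_ne (2 : Fin 3) 0 (by decide),
        pderiv_X_pow_ne (2 : Fin 3) 1 (by decide), a2, pderiv_X_pow_self (2 : Fin 3) (e + 1)]
      ring
    simp only [← map_add] at h
    rw [D0, D1, D2] at h
    have hr : eval (Pi.single 0 1 : Fin 3 → K) (pderiv j (X 0 ^ (e + 3) + X 1 ^ (e + 3) +
        C α * X 0 * X 2 ^ (e + 2) : MvPolynomial (Fin 3) K)) = 0 := by
      fin_cases j
      · exact absurd rfl hj
      · change eval _ (pderiv 1 _) = 0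
        rw [D1]; simp
      · change eval _ (pderiv 2 _) = 0
        rw [D2]; simp
    rw [hr] at h
    simp at h
    rcases h with h | h | h
    · exact h
    · exact absurd h e3
    · exact absurd h n0
  refine ⟨![Units.mk0 _ n0, Units.mk0 _ n1, Units.mk0 _ n2], ?_⟩
  apply Units.ext
  rw [dg_val]
  ext i j
  fin_cases i <;> fin_cases j <;>
    simp [z10, z12, z20, z21, z0 1 (by decide), z0 2 (by decide)]

lemma aut_pow (d : ℕ) (hd : 4 ≤ d) (α : K) (hα : α ≠ 0) (t s : Fin 3 → Kˣ) (h0 : t 0 = 1)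
    (h1 : IsPrimitiveRoot (t 1) d) (h2 : IsPrimitiveRoot (t 2) (d - 1))
    (hs : dg s ∈ autGL (X 0 ^ d + X 1 ^ d + C α * X 0 * X 2 ^ (d - 1) : MvPolynomial (Fin 3) K)) :
    ∃ k : ℕ, QuotientGroup.mk' (Subgroup.center (GL (Fin 3) K)) (dg t) ^ k =
      QuotientGroup.mk' (Subgroup.center (GL (Fin 3) K)) (dg s) := by
  have : NeZero d := ⟨by omega⟩
  have : NeZero (d - 1) := ⟨by omega⟩
  obtain ⟨l, hl⟩ := hs
  have hev : ∀ x : Fin 3 → K, (s 0 * x 0 : K) ^ d + (s 1 * x 1) ^ d +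
      α * (s 0 * x 0) * (s 2 * x 2) ^ (d - 1) =
      l * (x 0 ^ d + x 1 ^ d + α * x 0 * x 2 ^ (d - 1)) := by
    intro x
    have := congrArg (eval x) hl
    rw [eval_substPoly, dg_val] at this
    simpa [Matrix.mulVec_diagonal, mul_add] using this
  have hd0 : d ≠ 0 := by omega
  have hd1 : d - 1 ≠ 0 := by omega
  have E0 := hev ![1, 0, 0]
  have E1 := hev ![0, 1, 0]
  have E2 := hev ![1, 0, 1]
  simp [hd0, hd1] at E0 E1 E2
  have E3 : (s 0 : K) * (s 2 : K) ^ (d - 1) = l := by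
    apply mul_left_cancel₀ hα
    linear_combination E2 - E0
  have U0 : s 0 ^ d = l := by ext; push_cast; exact E0
  have U1 : s 1 ^ d = l := by ext; push_cast; exact E1
  have U2 : s 0 * s 2 ^ (d - 1) = l := by ext; push_cast; exact E3
  have V1 : (s 1 / s 0) ^ d = 1 := by rw [div_pow, U0, U1, div_self']
  have V2 : (s 2 / s 0) ^ (d - 1) = 1 := by
    rw [div_pow, div_eq_one]
    apply mul_left_cancel (a := s 0)
    rw [U2, ← pow_succ', show d - 1 + 1 = d by omega, U0]
  have G1 : ∃ i : ℕ, t 1 ^ i = s 1 / s 0 := by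
    have V1' : (((s 1 / s 0 : Kˣ)) : K) ^ d = 1 := by
      rw [← Units.val_pow_eq_pow_val, V1, Units.val_one]
    obtain ⟨i, -, hi⟩ := (IsPrimitiveRoot.coe_units_iff.2 h1).eq_pow_of_pow_eq_one V1'
    exact ⟨i, Units.ext (by push_cast at hi ⊢; exact hi)⟩
  have G2 : ∃ i : ℕ, t 2 ^ i = s 2 / s 0 := by
    have V2' : (((s 2 / s 0 : Kˣ)) : K) ^ (d - 1) = 1 := by
      rw [← Units.val_pow_eq_pow_val, V2, Units.val_one]
    obtain ⟨i, -, hi⟩ := (IsPrimitiveRoot.coe_units_iff.2 h2).eq_pow_of_pow_eq_one V2'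
    exact ⟨i, Units.ext (by push_cast at hi ⊢; exact hi)⟩
  obtain ⟨i, hi⟩ := G1
  obtain ⟨j, hj⟩ := G2
  have hco : Nat.Coprime d (d - 1) := by
    have := (Nat.coprime_self_add_right (m := d - 1) (n := 1)).2 (Nat.coprime_one_right _)
    rw [show d - 1 + 1 = d by omega] at this
    exact this.symm
  obtain ⟨k, hk1, hk2⟩ := Nat.chineseRemainder hco i j
  refine ⟨k, ?_⟩
  have P1 : t 1 ^ k = t 1 ^ i := by
    rw [pow_eq_pow_iff_modEq, ← h1.eq_orderOf]; exact hk1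
  have P2 : t 2 ^ k = t 2 ^ j := by
    rw [pow_eq_pow_iff_modEq, ← h2.eq_orderOf]; exact hk2
  rw [← map_pow, ← map_pow]
  apply QuotientGroup.eq.2
  rw [← map_inv, ← map_mul, dg_mem_center]
  simp [h0, P1, P2, hi, hj]

lemma cyc [IsAlgClosed K] (d : ℕ) (hd : 5 ≤ d) (α : K) (hα : α ≠ 0) :
    IsCyclic ↥(projAut (X 0 ^ d + X 1 ^ d + C α * X 0 * X 2 ^ (d - 1) : MvPolynomial (Fin 3) K)) ∧
    Nat.card ↥(projAut (X 0 ^ d + X 1 ^ d + C α * X 0 * X 2 ^ (d - 1) :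
      MvPolynomial (Fin 3) K)) = d * (d - 1) := by
  obtain ⟨t, h0, h1, h2⟩ := model_gen (K := K) d (by omega)
  have hz : projAut (X 0 ^ d + X 1 ^ d + C α * X 0 * X 2 ^ (d - 1) : MvPolynomial (Fin 3) K) =
      Subgroup.zpowers (QuotientGroup.mk' (Subgroup.center (GL (Fin 3) K)) (dg t)) := by
    apply le_antisymm
    · rintro _ ⟨A, hA, rfl⟩
      have hA' : A ∈ autGL (X 0 ^ d + X 1 ^ d + C α * X 0 * X 2 ^ (d - 1) :
        MvPolynomial (Fin 3) K) := hA
      obtain ⟨e, rfl⟩ : ∃ e, d = e + 3 := ⟨d - 3, by omega⟩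
      obtain ⟨s, rfl⟩ := aut_diag e (by omega) α hα A hA'
      obtain ⟨k, hk⟩ := aut_pow (e + 3) (by omega) α hα t s h0 h1 h2 hA'
      rw [← hk]
      exact pow_mem (Subgroup.mem_zpowers _) k
    · rw [Subgroup.zpowers_le]
      exact ⟨dg t, model_gen_mem d (by omega) α t h0 h1 h2, rfl⟩
  rw [hz]
  refine ⟨inferInstance, ?_⟩
  rw [Nat.card_zpowers]
  exact model_gen_order d (by omega) t h0 h1 h2

end final


/-- a nonsingular plane curve of degree `d ≥ 4` has an automorphism of
order `d(d-1)` iff it is projectively equivalent to `X^d + Y^d + α·X·Z^(d-1)` for some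
`α ≠ 0`; moreover for `d ≥ 5` the automorphism group of the latter curve is cyclic of
order `d(d-1)`. -/
theorem stmt1 {K : Type*} [Field K] [IsAlgClosed K] [CharZero K]
    (d : ℕ) (hd : 4 ≤ d) :
    (∀ F : MvPolynomial (Fin 3) K, F.IsHomogeneous d → IsNonsingular F →
      ((∃ g ∈ projAut F, orderOf g = d * (d - 1)) ↔
        ∃ α : K, α ≠ 0 ∧
          ProjEquiv F (X 0 ^ d + X 1 ^ d + C α * X 0 * X 2 ^ (d - 1)))) ∧
    (∀ α : K, α ≠ 0 → 5 ≤ d → ∀ F : MvPolynomial (Fin 3) K,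
      F = X 0 ^ d + X 1 ^ d + C α * X 0 * X 2 ^ (d - 1) →
      IsCyclic ↥(projAut F) ∧ Nat.card ↥(projAut F) = d * (d - 1)) := by
  refine ⟨fun F hF hns => ⟨forward d hd F hF hns, fun ⟨α, _, h⟩ => backward d hd F α h⟩, ?_⟩
  intro α hα hd5 F hF
  subst hF
  exact cyc d hd5 α hα

end
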